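/- Let A be a local ring and let C be a homologically finite complex of A-modules. If for some n ≥ sup C = sup { i : H_i(C) ≠ 0 } the A-module Coker(C_{n+1} → C_n) (computed from a minimal complex of finitely generated free A-modules quasi-isomorphic to C) has finite CI-dimension, then the complex C has finite CI-dimension. -/

import Mathlib

open IsLocalRing CategoryTheory

universe u

noncomputable section

/-! Basic commutative-algebra notions: depth, minimal free resolutions, Betti numbers,
complexity, syzygies, reducible complexity, upper reducing degree, Tor-independence,
Gorenstein dimension, CI-dimension, Cohen-Macaulay local rings. -/




/-- The depth of a module over a local ring: the supremum of lengths of regular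
sequences on the module consisting of elements of the maximal ideal. -/
def moduleDepth (A : Type u) [CommRing A] [IsLocalRing A]
    (M : Type u) [AddCommGroup M] [Module A M] : ℕ∞ :=
  sSup {n : ℕ∞ | ∃ rs : List A, (rs.length : ℕ∞) = n ∧
    (∀ x ∈ rs, x ∈ maximalIdeal A) ∧ RingTheory.Sequence.IsRegular M rs}

/-- A minimal free resolution of a module over a local ring. -/
structure MinFreeRes (A : Type u) [CommRing A] [IsLocalRing A]
    (M : Type u) [AddCommGroup M] [Module A M] : Type (u + 1) where
  F : ℕ → ModuleCat.{u} A
  free : ∀ n, Module.Free A (F n)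
  fin : ∀ n, Module.Finite A (F n)
  d : ∀ n, F (n + 1) →ₗ[A] F n
  aug : F 0 →ₗ[A] M
  aug_surj : Function.Surjective aug
  exact_aug : Function.Exact (d 0) aug
  exact_d : ∀ n, Function.Exact (d (n + 1)) (d n)
  minimal : ∀ n x, d n x ∈ (maximalIdeal A) • (⊤ : Submodule A (F n))

/-- The Betti numbers of a minimal free resolution. -/
def MinFreeRes.betti {A : Type u} [CommRing A] [IsLocalRing A]
    {M : Type u} [AddCommGroup M] [Module A M] (R : MinFreeRes A M) (n : ℕ) : ℕ :=
  Module.finrank A (R.F n)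

/-- The sequence `β` is eventually bounded by `a * n ^ (t - 1)` for some real `a`. -/
def CxBound (β : ℕ → ℕ) (t : ℕ) : Prop :=
  ∃ a : ℝ, ∃ N : ℕ, ∀ n, N ≤ n → (β n : ℝ) ≤ a * (n : ℝ) ^ ((t : ℝ) - 1)

/-- The complexity of a module: the least `t` such that the Betti sequence of a minimal
free resolution is eventually bounded by `a * n ^ (t - 1)` for some `a` (and `⊤` if no
such `t` exists). -/
def complexity (A : Type u) [CommRing A] [IsLocalRing A]
    (M : Type u) [AddCommGroup M] [Module A M] : ℕ∞ :=
  sInf {t : ℕ∞ | ∃ t' : ℕ, t = (t' : ℕ∞) ∧ ∃ R : MinFreeRes A M, CxBound R.betti t'}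

/-- A finite resolution of a module `M`:
an exact sequence `0 → G len → ⋯ → G 0 → M → 0`. -/
structure FinRes (A : Type u) [CommRing A]
    (M : Type u) [AddCommGroup M] [Module A M] : Type (u + 1) where
  len : ℕ
  G : ℕ → ModuleCat.{u} A
  d : ∀ n, G (n + 1) →ₗ[A] G n
  aug : G 0 →ₗ[A] M
  bounded : ∀ n, len < n → Subsingleton (G n)
  aug_surj : Function.Surjective aug
  exact_aug : Function.Exact (d 0) aug
  exact_d : ∀ n, Function.Exact (d (n + 1)) (d n)

/-- A module has finite projective dimension if it admits a finite resolution by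
projective modules. -/
def HasFiniteProjDim (A : Type u) [CommRing A]
    (M : Type u) [AddCommGroup M] [Module A M] : Prop :=
  ∃ R : FinRes A M, ∀ n, Module.Projective A (R.G n)

/-- `S` is an `n`-th syzygy of `M`: for `n = 0`, `S ≅ M`; for `n ≥ 1`, `S` is isomorphic to
the image of the `n`-th differential in a minimal free resolution of `M`. -/
def IsSyzygy (A : Type u) [CommRing A] [IsLocalRing A]
    (M : Type u) [AddCommGroup M] [Module A M]
    (S : Type u) [AddCommGroup S] [Module A S] : ℕ → Prop
  | 0 => Nonempty (S ≃ₗ[A] M)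
  | (n + 1) => ∃ R : MinFreeRes A M, Nonempty (S ≃ₗ[A] LinearMap.range (R.d n))

/-- `K` is obtained from `M` by a reduction of complexity coming from a cohomology class
of degree `t ≥ 1`, i.e. there is a short exact sequence `0 → M → K → Ω^{t-1}(M) → 0`. -/
def ReducesWithDeg (A : Type u) [CommRing A] [IsLocalRing A]
    (M K : ModuleCat.{u} A) (t : ℕ) : Prop :=
  1 ≤ t ∧ ∃ (S : Type u) (_ : AddCommGroup S) (_ : Module A S),
    IsSyzygy A M S (t - 1) ∧
    ∃ (f : M →ₗ[A] K) (g : K →ₗ[A] S),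
      Function.Injective f ∧ Function.Surjective g ∧ Function.Exact f g

/-- The class of (bundled) modules having reducible complexity: the smallest class
containing all modules of finite projective dimension, and containing every module `M` of
finite positive complexity admitting a short exact sequence
`0 → M → K → Ω^{t-1}(M) → 0` (coming from a degree-`t` self-extension) with
`cx K < cx M` and `K` of reducible complexity. -/
inductive HasRedCxCat (A : Type u) [CommRing A] [IsLocalRing A] : ModuleCat.{u} A → Prop
  | of_finite_pd (M : ModuleCat.{u} A) : HasFiniteProjDim A M → HasRedCxCat A M
  | of_step (M K : ModuleCat.{u} A) (t : ℕ) :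
      complexity A M ≠ 0 → complexity A M ≠ ⊤ →
      ReducesWithDeg A M K t →
      complexity A K < complexity A M →
      HasRedCxCat A K → HasRedCxCat A M

/-- A module has reducible complexity. -/
def HasReducibleComplexity (A : Type u) [CommRing A] [IsLocalRing A]
    (M : Type u) [AddCommGroup M] [Module A M] : Prop :=
  HasRedCxCat A (ModuleCat.of A M)

/-- A sequence of short exact sequences `0 → K_{i-1} → K_i → Ω^{d_i - 1}(K_{i-1}) → 0`
with strictly decreasing complexities, ending in a module of complexity zero, i.e. a
sequence reducing the complexity of `Ks 0`. -/
def IsReducingSeq (A : Type u) [CommRing A] [IsLocalRing A] (t : ℕ)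
    (Ks : Fin (t + 1) → ModuleCat.{u} A) (degs : Fin t → ℕ) : Prop :=
  (∀ i : Fin t, ReducesWithDeg A (Ks i.castSucc) (Ks i.succ) (degs i)) ∧
  (∀ i : Fin t, complexity A (Ks i.succ) < complexity A (Ks i.castSucc)) ∧
  complexity A (Ks (Fin.last t)) = 0

open Classical in
/-- The upper reducing degree of `M`: `⊤` if `M` has finite projective dimension, and
otherwise the supremum, over all sequences reducing the complexity of `M`, of the minimum
of the degrees of the cohomology classes involved. -/
def upperReducingDegree (A : Type u) [CommRing A] [IsLocalRing A]
    (M : Type u) [AddCommGroup M] [Module A M] : ℕ∞ :=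
  if HasFiniteProjDim A M then ⊤
  else sSup {r : ℕ∞ | ∃ (t : ℕ) (Ks : Fin (t + 1) → ModuleCat.{u} A) (degs : Fin t → ℕ),
    Ks 0 = ModuleCat.of A M ∧ IsReducingSeq A t Ks degs ∧
    r = ⨅ i : Fin t, (degs i : ℕ∞)}

/-- The `n`-th Tor module of two modules. -/
def torModule (A : Type u) [CommRing A] (M N : Type u)
    [AddCommGroup M] [Module A M] [AddCommGroup N] [Module A N] (n : ℕ) : ModuleCat.{u} A :=
  ((Tor (ModuleCat.{u} A) n).obj (ModuleCat.of A M)).obj (ModuleCat.of A N)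

/-- Two modules are Tor-independent if `Tor_n(M, N) = 0` for all `n > 0`. -/
def TorIndep (A : Type u) [CommRing A] (M N : Type u)
    [AddCommGroup M] [Module A M] [AddCommGroup N] [Module A N] : Prop :=
  ∀ n : ℕ, 0 < n → Subsingleton (torModule A M N n)

/-- The `n`-th Ext module of two modules. -/
def extModule (A : Type u) [CommRing A] (M N : Type u)
    [AddCommGroup M] [Module A M] [AddCommGroup N] [Module A N] (n : ℕ) : ModuleCat.{u} A :=
  ((Ext A (ModuleCat.{u} A) n).obj (Opposite.op (ModuleCat.of A M))).obj (ModuleCat.of A N)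

/-- A module `G` has Gorenstein dimension zero if it is reflexive and
`Ext^n(G, A) = 0 = Ext^n(Hom(G, A), A)` for all `n > 0`. -/
def GDimZero (A : Type u) [CommRing A] (G : Type u) [AddCommGroup G] [Module A G] : Prop :=
  Module.IsReflexive A G ∧
  ∀ n : ℕ, 0 < n →
    Subsingleton (extModule A G A n) ∧ Subsingleton (extModule A (Module.Dual A G) A n)

/-- A module has finite Gorenstein dimension if it admits a finite resolution by modules
of Gorenstein dimension zero. -/
def HasFiniteGDim (A : Type u) [CommRing A]
    (M : Type u) [AddCommGroup M] [Module A M] : Prop :=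
  ∃ R : FinRes A M, ∀ n, GDimZero A (R.G n)


/-- The Krull dimension of a ring, viewed in `WithBot ℕ∞`. -/
def ringKrullDimE (A : Type u) [CommRing A] : WithBot ℕ∞ := ringKrullDim A

/-- A local ring is Cohen-Macaulay if its depth equals its Krull dimension. -/
def IsCMLocalRing (A : Type u) [CommRing A] [IsLocalRing A] : Prop :=
  (moduleDepth A A : WithBot ℕ∞) = ringKrullDimE A

/-- A module over a local ring is maximal Cohen-Macaulay if its depth equals the Krull
dimension of the ring. -/
def IsMaxCM (A : Type u) [CommRing A] [IsLocalRing A]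
    (M : Type u) [AddCommGroup M] [Module A M] : Prop :=
  (moduleDepth A M : WithBot ℕ∞) = ringKrullDimE A

/-- A local ring is Gorenstein if and only if every finitely generated module over it has
finite Gorenstein dimension. -/
def IsGorensteinLocalRing (A : Type u) [CommRing A] [IsLocalRing A] : Prop :=
  ∀ M : ModuleCat.{u} A, Module.Finite A M → HasFiniteGDim A M

/-- A module `M` over a local ring `A` has finite CI-dimension if there is a diagram of
local ring homomorphisms `A → R ← Q` with `A → R` flat and `Q → R` surjective with kernel
generated by a regular sequence, such that `R ⊗_A M` has finite projective dimension
over `Q`. -/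
def HasFiniteCIDimMod (A : Type u) [CommRing A] [IsLocalRing A]
    (M : Type u) [AddCommGroup M] [Module A M] : Prop :=
  ∃ (R Q : Type u) (_ : CommRing R) (_ : CommRing Q) (_ : IsLocalRing R) (_ : IsLocalRing Q)
    (f : A →+* R) (g : Q →+* R),
    IsLocalHom f ∧ IsLocalHom g ∧ Function.Surjective g ∧
    (∃ rs : List Q, RingTheory.Sequence.IsRegular Q rs ∧
      RingHom.ker g = Ideal.span {x | x ∈ rs}) ∧
    (letI : Algebra A R := f.toAlgebra
     Module.Flat A R ∧
     (letI : Module Q (TensorProduct A R M) := Module.compHom _ g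
      HasFiniteProjDim Q (TensorProduct A R M)))





/-- A (ℤ-indexed) chain complex of `A`-modules, with differentials of degree `-1`
recorded, Mathlib-style, as a family of maps `d i j : X i → X j` vanishing
unless `j + 1 = i`. -/
structure Cx (A : Type u) [CommRing A] : Type (u + 1) where
  X : ℤ → ModuleCat.{u} A
  d : ∀ i j : ℤ, X i →ₗ[A] X j
  shape : ∀ i j : ℤ, j + 1 ≠ i → d i j = 0
  dsq : ∀ i j k : ℤ, (d j k).comp (d i j) = 0

/-- A chain map between complexes. -/
structure CxHom {A : Type u} [CommRing A] (C D : Cx A) : Type u where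
  f : ∀ i : ℤ, C.X i →ₗ[A] D.X i
  comm : ∀ i j : ℤ, (D.d i j).comp (f i) = (f j).comp (C.d i j)

variable {A : Type u} [CommRing A]

/-- The `n`-th suspension `Σ^n C` of a complex: `(Σ^n C)_i = C_{i-n}`, with differential
multiplied by `(-1)^n`. -/
def Cx.shift (C : Cx A) (n : ℕ) : Cx A where
  X i := C.X (i - n)
  d i j := ((-1 : A) ^ n) • C.d (i - n) (j - n)
  shape i j h := by
    have : (j : ℤ) - n + 1 ≠ i - n := by omega
    show ((-1 : A) ^ n) • C.d (i - n) (j - n) = 0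
    rw [C.shape _ _ this, smul_zero]
  dsq i j k := by
    ext x
    simp only [LinearMap.comp_apply, LinearMap.smul_apply, LinearMap.zero_apply, map_smul]
    rw [← LinearMap.comp_apply (C.d (j - n) (k - n)), C.dsq]
    simp

/-- The cycles of a complex in degree `i`. -/
def Cx.cycles (C : Cx A) (i : ℤ) : Submodule A (C.X i) := LinearMap.ker (C.d i (i - 1))

/-- The boundaries of a complex in degree `i`. -/
def Cx.bnd (C : Cx A) (i : ℤ) : Submodule A (C.X i) := LinearMap.range (C.d (i + 1) i)

/-- The homology of a complex in degree `i`. -/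
def Cx.homology (C : Cx A) (i : ℤ) : Type u :=
  C.cycles i ⧸ ((C.bnd i).comap (C.cycles i).subtype)

instance (C : Cx A) (i : ℤ) : AddCommGroup (C.homology i) :=
  inferInstanceAs (AddCommGroup (C.cycles i ⧸ ((C.bnd i).comap (C.cycles i).subtype)))

instance (C : Cx A) (i : ℤ) : Module A (C.homology i) :=
  inferInstanceAs (Module A (C.cycles i ⧸ ((C.bnd i).comap (C.cycles i).subtype)))

/-- The map induced on homology by a chain map. -/
def CxHom.homologyMap {C D : Cx A} (φ : CxHom C D) (i : ℤ) :
    C.homology i →ₗ[A] D.homology i := by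
  refine Submodule.mapQ _ _ ((φ.f i).restrict (p := C.cycles i) (q := D.cycles i) ?_) ?_
  · intro x hx
    have h := congrArg (fun ψ => ψ x) (φ.comm i (i - 1))
    simp only [LinearMap.comp_apply] at h
    simp only [Cx.cycles, LinearMap.mem_ker] at hx ⊢
    rw [h, hx, map_zero]
  · rintro ⟨x, hx⟩ hmem
    simp only [Submodule.mem_comap, Submodule.subtype_apply] at hmem ⊢
    obtain ⟨y, hy⟩ := hmem
    have h := congrArg (fun ψ => ψ y) (φ.comm (i + 1) i)
    simp only [LinearMap.comp_apply] at h
    refine ⟨φ.f (i + 1) y, ?_⟩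
    rw [h, hy]
    rfl

/-- A chain map is a quasi-isomorphism if it induces isomorphisms on all homology. -/
def CxHom.IsQuasiIso {C D : Cx A} (φ : CxHom C D) : Prop :=
  ∀ i : ℤ, Function.Bijective (φ.homologyMap i)

/-- A complex is homologically finite if its homology is bounded and degreewise
finitely generated. -/
def Cx.HomFinite (C : Cx A) : Prop :=
  (∃ a b : ℤ, ∀ i, (i < a ∨ b < i) → Subsingleton (C.homology i)) ∧
  ∀ i, Module.Finite A (C.homology i)

/-- A bounded below, degreewise finitely generated free complex which is minimal
(the differentials map into `m` times the next module). -/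
def Cx.IsMinFree [IsLocalRing A] (C : Cx A) : Prop :=
  (∃ n₀ : ℤ, ∀ i, i < n₀ → Subsingleton (C.X i)) ∧
  (∀ i, Module.Free A (C.X i) ∧ Module.Finite A (C.X i)) ∧
  (∀ i j (x : C.X i), C.d i j x ∈ (maximalIdeal A) • (⊤ : Submodule A (C.X j)))

/-- `F` is a minimal free resolution of the complex `C`. -/
def IsMinFreeResCx [IsLocalRing A] (F C : Cx A) : Prop :=
  F.IsMinFree ∧ ∃ φ : CxHom F C, φ.IsQuasiIso

/-- A perfect complex: a bounded complex of finitely generated projective modules. -/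
def Cx.IsPerfect (C : Cx A) : Prop :=
  (∃ a b : ℤ, ∀ i, (i < a ∨ b < i) → Subsingleton (C.X i)) ∧
  ∀ i, Module.Finite A (C.X i) ∧ Module.Projective A (C.X i)

/-- A complex has finite projective dimension if it is quasi-isomorphic to a perfect
complex. -/
def Cx.HasFinitePD (C : Cx A) : Prop :=
  ∃ P : Cx A, P.IsPerfect ∧ ∃ φ : CxHom P C, φ.IsQuasiIso

/-- `K` is (isomorphic to) the mapping cone of the chain map `g : C → D`:
there are maps `ι : D → K` and `π : K → ΣC` exhibiting a degreewise split short exact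
sequence `0 → D → K → ΣC → 0`, via a degreewise splitting `s`, such that the
differential of `K` restricted along `s` is given by `g` (up to the sign conventions of
the cone construction). -/
def IsConeOf {A : Type u} [CommRing A] {C D : Cx A} (g : CxHom C D) (K : Cx A) : Prop :=
  ∃ (ι : ∀ i : ℤ, D.X i →ₗ[A] K.X i) (π : ∀ i : ℤ, K.X i →ₗ[A] C.X (i - 1))
    (s : ∀ i : ℤ, C.X (i - 1) →ₗ[A] K.X i),
    (∀ i j : ℤ, (K.d i j).comp (ι i) = (ι j).comp (D.d i j)) ∧
    (∀ i j : ℤ, (π j).comp (K.d i j) = (-1 : A) • ((C.d (i - 1) (j - 1)).comp (π i))) ∧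
    (∀ i, Function.Injective (ι i)) ∧
    (∀ i, (π i).comp (ι i) = 0) ∧
    (∀ i, (π i).comp (s i) = LinearMap.id) ∧
    (∀ i (x : K.X i), ∃ y, x = ι i y + s i (π i x)) ∧
    (∀ i (c : C.X (i - 1)),
      K.d i (i - 1) (s i c) = ι (i - 1) (g.f (i - 1) c) - s (i - 1) (C.d (i - 1) (i - 1 - 1) c))

/-- The complexity of a homologically finite complex: the least `t` such that the Betti
sequence (the ranks of the modules in a minimal free resolution) is eventually bounded by
`a * n ^ (t - 1)` for some `a`. -/
def cxComplexity (A : Type u) [CommRing A] [IsLocalRing A] (C : Cx A) : ℕ∞ :=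
  sInf {t : ℕ∞ | ∃ t' : ℕ, t = (t' : ℕ∞) ∧ ∃ F : Cx A, IsMinFreeResCx F C ∧
    CxBound (fun n => Module.finrank A (F.X (n : ℤ))) t'}

/-- The class of complexes having reducible complexity: the smallest class of
homologically finite complexes containing the complexes of finite projective dimension,
and containing every complex `C` of finite positive complexity admitting a triangle
`C → Σ^n C → K → Σ C` with `n > 0`, `cx K < cx C` and `K` of reducible complexity.
(The triangle is realized by taking the mapping cone of a chain map `F → Σ^n F` for a
minimal free resolution `F` of `C`.) -/
inductive CxRedCx (A : Type u) [CommRing A] [IsLocalRing A] : Cx A → Prop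
  | of_finite_pd (C : Cx A) : C.HasFinitePD → CxRedCx A C
  | of_step (C : Cx A) (n : ℕ) (F : Cx A) (g : CxHom F (F.shift n)) (K : Cx A) :
      0 < n →
      cxComplexity A C ≠ 0 → cxComplexity A C ≠ ⊤ →
      IsMinFreeResCx F C →
      IsConeOf g K →
      cxComplexity A K < cxComplexity A C →
      CxRedCx A K → CxRedCx A C

/-- The base change of a complex of `A`-modules along `A → R`. -/
def Cx.baseChange {A : Type u} [CommRing A] (R : Type u) [CommRing R] [Algebra A R]
    (C : Cx A) : Cx R where
  X i := ModuleCat.of R (TensorProduct A R (C.X i))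
  d i j := (C.d i j).baseChange R
  shape i j h := by
    show (C.d i j).baseChange R = 0
    rw [C.shape i j h, LinearMap.baseChange_zero]
  dsq i j k := by
    show ((C.d j k).baseChange R).comp ((C.d i j).baseChange R) = 0
    rw [← LinearMap.baseChange_comp, C.dsq, LinearMap.baseChange_zero]

/-- The restriction of scalars of a complex of `R`-modules along a ring map `Q → R`. -/
def Cx.restrict {R : Type u} [CommRing R] {Q : Type u} [CommRing Q] (g : Q →+* R)
    (D : Cx R) : Cx Q :=
  letI : ∀ i, Module Q (D.X i) := fun i => Module.compHom _ g
  { X := fun i => ModuleCat.of Q (D.X i)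
    d := fun i j =>
      { toFun := D.d i j
        map_add' := (D.d i j).map_add
        map_smul' := fun q x => (D.d i j).map_smul (g q) x }
    shape := fun i j h => by
      ext x
      show D.d i j x = 0
      rw [D.shape i j h]
      rfl
    dsq := fun i j k => by
      ext x
      show D.d j k (D.d i j x) = 0
      rw [← LinearMap.comp_apply, D.dsq]
      rfl }

/-- A complex `C` over a local ring `A` has finite CI-dimension if there is a diagram of
local ring homomorphisms `A → R ← Q` with `A → R` flat and `Q → R` surjective with kernel
generated by a regular sequence, such that `R ⊗_A C` has finite projective dimension as a
complex of `Q`-modules. -/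
def Cx.HasFiniteCIDim (A : Type u) [CommRing A] [IsLocalRing A] (C : Cx A) : Prop :=
  ∃ (R Q : Type u) (_ : CommRing R) (_ : CommRing Q) (_ : IsLocalRing R) (_ : IsLocalRing Q)
    (f : A →+* R) (g : Q →+* R),
    IsLocalHom f ∧ IsLocalHom g ∧ Function.Surjective g ∧
    (∃ rs : List Q, RingTheory.Sequence.IsRegular Q rs ∧
      RingHom.ker g = Ideal.span {x | x ∈ rs}) ∧
    (letI : Algebra A R := f.toAlgebra
     Module.Flat A R ∧ ((C.baseChange R).restrict g).HasFinitePD)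

/-- The complex `F` is a resolution of the module `M`: it vanishes in negative degrees,
is exact in positive degrees, and has `H₀ ≅ M` via an augmentation map. -/
def IsResolutionOfModule {A : Type u} [CommRing A] (F : Cx A)
    (M : Type u) [AddCommGroup M] [Module A M] : Prop :=
  (∀ i : ℤ, i < 0 → Subsingleton (F.X i)) ∧
  ∃ aug : F.X 0 →ₗ[A] M, Function.Surjective aug ∧ Function.Exact (F.d 1 0) aug ∧
    ∀ i : ℤ, 1 ≤ i → Function.Exact (F.d (i + 1) i) (F.d i (i - 1))

/-- The complex `F` is a free resolution of the module `M`. -/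
def IsFreeResolutionOfModule {A : Type u} [CommRing A] (F : Cx A)
    (M : Type u) [AddCommGroup M] [Module A M] : Prop :=
  IsResolutionOfModule F M ∧ ∀ i, Module.Free A (F.X i) ∧ Module.Finite A (F.X i)

section Syzygies

variable {Q : Type u} [CommRing Q]

/-- A class of modules closed under extensions and kernels of surjections, containing the
zero modules. -/
structure IsResolvingClass (𝒞 : ∀ (N : Type u) [AddCommGroup N] [Module Q N], Prop) : Prop where
  of_subsingleton (N : Type u) [AddCommGroup N] [Module Q N] [Subsingleton N] : 𝒞 N
  ext {X Y Z : Type u} [AddCommGroup X] [Module Q X] [AddCommGroup Y] [Module Q Y]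
    [AddCommGroup Z] [Module Q Z] (f : X →ₗ[Q] Y) (g : Y →ₗ[Q] Z) :
    Function.Injective f → Function.Surjective g → Function.Exact f g → 𝒞 X → 𝒞 Z → 𝒞 Y
  ker {X Y Z : Type u} [AddCommGroup X] [Module Q X] [AddCommGroup Y] [Module Q Y]
    [AddCommGroup Z] [Module Q Z] (f : X →ₗ[Q] Y) (g : Y →ₗ[Q] Z) :
    Function.Injective f → Function.Surjective g → Function.Exact f g → 𝒞 Y → 𝒞 Z → 𝒞 X

namespace IsResolvingClass

variable {𝒞 : ∀ (N : Type u) [AddCommGroup N] [Module Q N], Prop}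
  {X Y : Type u} [AddCommGroup X] [Module Q X] [AddCommGroup Y] [Module Q Y]

lemma of_equiv (h𝒞 : IsResolvingClass 𝒞) (e : X ≃ₗ[Q] Y) (h : 𝒞 X) : 𝒞 Y :=
  h𝒞.ext (Z := PUnit) e.toLinearMap 0 e.injective (fun z => ⟨0, Subsingleton.elim _ _⟩)
    (fun y => by simp) h (h𝒞.of_subsingleton _)

lemma prod (h𝒞 : IsResolvingClass 𝒞) (hX : 𝒞 X) (hY : 𝒞 Y) : 𝒞 (X × Y) :=
  h𝒞.ext (LinearMap.inl Q X Y) (LinearMap.snd Q X Y) LinearMap.inl_injective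
    LinearMap.snd_surjective Function.Exact.inl_snd hX hY

lemma finFun (h𝒞 : IsResolvingClass 𝒞) (hX : 𝒞 X) (r : ℕ) : 𝒞 (Fin r → X) := by
  induction r with
  | zero => exact h𝒞.of_subsingleton _
  | succ r ih => exact h𝒞.of_equiv (Fin.consLinearEquiv Q fun _ : Fin (r + 1) => X) (h𝒞.prod hX ih)

lemma ker_surjective (h𝒞 : IsResolvingClass 𝒞) (g : X →ₗ[Q] Y) (hg : Function.Surjective g)
    (hX : 𝒞 X) (hY : 𝒞 Y) :
    𝒞 (LinearMap.ker g) :=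
  h𝒞.ker (LinearMap.ker g).subtype g Subtype.val_injective hg
    (LinearMap.exact_subtype_ker_map g) hX hY

end IsResolvingClass

/-- `N` admits `k` steps of a resolution by finite free modules, with finite `k`-th syzygy. -/
def IsFPn (Q : Type u) [CommRing Q] :
    ℕ → ∀ (N : Type u) [AddCommGroup N] [Module Q N], Prop
  | 0, N, _, _ => Module.Finite Q N
  | k + 1, N, _, _ => ∃ (r : ℕ) (f : (Fin r → Q) →ₗ[Q] N),
      Function.Surjective f ∧ IsFPn Q k (LinearMap.ker f)

namespace IsFPn

variable {X Y Z : Type u} [AddCommGroup X] [Module Q X] [AddCommGroup Y] [Module Q Y]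
    [AddCommGroup Z] [Module Q Z]

lemma finite : ∀ {k : ℕ}, IsFPn Q k X → Module.Finite Q X
  | 0, h => h
  | _ + 1, ⟨_, f, hf, _⟩ => Module.Finite.of_surjective f hf

lemma of_subsingleton [Subsingleton X] (k : ℕ) : IsFPn Q k X := by
  induction k generalizing X with
  | zero => exact (inferInstance : Module.Finite Q X)
  | succ k ih => exact ⟨0, 0, fun x => ⟨0, Subsingleton.elim _ _⟩, ih⟩

lemma ext {k : ℕ} (f : X →ₗ[Q] Y) (g : Y →ₗ[Q] Z) (hf : Function.Injective f)
    (hg : Function.Surjective g) (hfg : Function.Exact f g)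
    (hX : IsFPn Q k X) (hZ : IsFPn Q k Z) : IsFPn Q k Y := by
  induction k generalizing X Y Z with
  | zero =>
    have := hX.finite
    have := hZ.finite
    exact Module.Finite.of_exact hfg hg
  | succ k ih =>
    obtain ⟨r, p, hp, hpk⟩ := hX
    obtain ⟨s, q, hq, hqk⟩ := hZ
    obtain ⟨q', hq'⟩ := Module.projective_lifting_property g q hg
    have hgf : ∀ x, g (f x) = 0 := hfg.apply_apply_eq_zero
    have hgq : ∀ x, g (q' x) = q x := fun x => LinearMap.congr_fun hq' x
    let e : (Fin (r + s) → Q) ≃ₗ[Q] (Fin r → Q) × (Fin s → Q) :=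
      (LinearEquiv.funCongrLeft Q Q finSumFinEquiv).trans
        (LinearEquiv.sumArrowLequivProdArrow (Fin r) (Fin s) Q Q)
    let c : ((Fin r → Q) × (Fin s → Q)) →ₗ[Q] Y := (f.comp p).coprod q'
    have hcs : Function.Surjective c := by
      intro y
      obtain ⟨v, hv⟩ := hq (g y)
      obtain ⟨x, hx⟩ := (hfg (y - q' v)).1 (by rw [map_sub, hgq, hv, sub_self])
      obtain ⟨w, rfl⟩ := hp x
      exact ⟨(w, v), by simp [c, hx]⟩
    have key : IsFPn Q k (LinearMap.ker (c.comp e.toLinearMap)) := by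
      have h1 : ∀ w : LinearMap.ker p, e.symm (w.1, 0) ∈ LinearMap.ker (c.comp e.toLinearMap) := by
        rintro ⟨w, hw⟩
        simp only [LinearMap.mem_ker] at hw
        simp [c, hw]
      have h2 : ∀ w : LinearMap.ker (c.comp e.toLinearMap), (e w.1).2 ∈ LinearMap.ker q := by
        rintro ⟨w, hw⟩
        have := congrArg g (LinearMap.mem_ker.1 hw)
        simpa [c, hgf, hgq] using this
      obtain ⟨ι, hι⟩ : ∃ ι : LinearMap.ker p →ₗ[Q] LinearMap.ker (c.comp e.toLinearMap),
          ∀ w, (ι w).1 = e.symm (w.1, 0) :=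
        ⟨((e.symm.toLinearMap.comp (LinearMap.inl Q _ _)).comp
          (LinearMap.ker p).subtype).codRestrict _ h1, fun _ => rfl⟩
      obtain ⟨π, hπ⟩ : ∃ π : LinearMap.ker (c.comp e.toLinearMap) →ₗ[Q] LinearMap.ker q,
          ∀ w, (π w).1 = (e w.1).2 :=
        ⟨((LinearMap.snd Q _ _).comp (e.toLinearMap.comp
          (LinearMap.ker (c.comp e.toLinearMap)).subtype)).codRestrict (LinearMap.ker q) h2,
          fun _ => rfl⟩
      refine ih ι π ?_ ?_ ?_ hpk hqk
      · intro a b hab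
        have := congrArg (fun z => (e z.1).1) hab
        simp only [hι, LinearEquiv.apply_symm_apply] at this
        exact Subtype.ext this
      · rintro ⟨v, hv⟩
        have hv' : g (q' v) = 0 := by rw [hgq]; exact hv
        obtain ⟨x, hx⟩ := (hfg _).1 hv'
        obtain ⟨w, rfl⟩ := hp x
        exact ⟨⟨e.symm (-w, v), by simp [c, hx]⟩, Subtype.ext (by simp [hπ])⟩
      · rintro ⟨w, hw⟩
        constructor
        · intro h0
          have h0' : (e w).2 = 0 := (hπ _).symm.trans (congrArg Subtype.val h0)
          have hw' : f (p (e w).1) = 0 := by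
            have := LinearMap.mem_ker.1 hw
            simpa [c, h0'] using this
          refine ⟨⟨(e w).1, hf (by simpa using hw')⟩, Subtype.ext (e.injective ?_)⟩
          rw [hι, LinearEquiv.apply_symm_apply]
          exact Prod.ext rfl h0'.symm
        · rintro ⟨v, hv⟩
          have hv' := congrArg Subtype.val hv
          rw [hι] at hv'
          exact Subtype.ext (by rw [hπ, ← hv', e.apply_symm_apply]; rfl)
    exact ⟨r + s, c.comp e.toLinearMap, hcs.comp e.surjective, key⟩

lemma of_equiv {k : ℕ} (e : X ≃ₗ[Q] Y) (h : IsFPn Q k X) : IsFPn Q k Y :=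
  ext (Z := PUnit) e.toLinearMap 0 e.injective (fun z => ⟨0, Subsingleton.elim _ _⟩)
    (fun y => by simp) h (of_subsingleton k)

lemma finFree (k r : ℕ) : IsFPn Q k (Fin r → Q) := by
  cases k with
  | zero => exact (inferInstance : Module.Finite Q (Fin r → Q))
  | succ k =>
    have : Subsingleton (LinearMap.ker (LinearMap.id : (Fin r → Q) →ₗ[Q] _)) := by
      rw [LinearMap.ker_id]; infer_instance
    exact ⟨r, LinearMap.id, Function.surjective_id, of_subsingleton k⟩

lemma quotient {k : ℕ} (f : X →ₗ[Q] Y) (g : Y →ₗ[Q] Z) (hf : Function.Injective f)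
    (hg : Function.Surjective g) (hfg : Function.Exact f g)
    (hX : IsFPn Q k X) (hY : IsFPn Q (k + 1) Y) : IsFPn Q (k + 1) Z := by
  obtain ⟨r, p, hp, hpk⟩ := hY
  refine ⟨r, g.comp p, hg.comp hp, ?_⟩
  let e : X ≃ₗ[Q] LinearMap.ker g :=
    (LinearEquiv.ofInjective f hf).trans (LinearEquiv.ofEq _ _ hfg.linearMap_ker_eq.symm)
  have h1 : ∀ w : LinearMap.ker p, w.1 ∈ LinearMap.ker (g.comp p) := by
    rintro ⟨w, hw⟩
    simp only [LinearMap.mem_ker] at hw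
    simp [hw]
  have h2 : ∀ w : LinearMap.ker (g.comp p), p w.1 ∈ LinearMap.ker g := fun w => w.2
  refine ext ((LinearMap.ker p).subtype.codRestrict _ h1)
    ((p.comp (LinearMap.ker (g.comp p)).subtype).codRestrict (LinearMap.ker g) h2)
    ?_ ?_ ?_ hpk (hX.of_equiv e)
  · intro a b hab
    have hab' : a.1 = b.1 := congrArg (fun z => z.1) hab
    exact Subtype.ext hab'
  · rintro ⟨y, hy⟩
    obtain ⟨v, rfl⟩ := hp y
    exact ⟨⟨v, hy⟩, rfl⟩
  · rintro ⟨w, hw⟩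
    constructor
    · intro h
      exact ⟨⟨w, congrArg Subtype.val h⟩, rfl⟩
    · rintro ⟨⟨v, hv⟩, h⟩
      obtain rfl : v = w := congrArg Subtype.val h
      exact Subtype.ext hv

lemma quotient' {k : ℕ} (f : X →ₗ[Q] Y) (g : Y →ₗ[Q] Z) (hf : Function.Injective f)
    (hg : Function.Surjective g) (hfg : Function.Exact f g)
    (hX : ∀ k, IsFPn Q k X) (hY : IsFPn Q k Y) : IsFPn Q k Z := by
  cases k with
  | zero =>
    have := hY.finite
    exact Module.Finite.of_surjective g hg
  | succ k => exact quotient f g hf hg hfg (hX k) hY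

lemma ker {k : ℕ} (f : X →ₗ[Q] Y) (g : Y →ₗ[Q] Z) (hf : Function.Injective f)
    (hg : Function.Surjective g) (hfg : Function.Exact f g)
    (hY : IsFPn Q k Y) (hZ : IsFPn Q (k + 1) Z) : IsFPn Q k X := by
  obtain ⟨r, p, hp, hpk⟩ := hZ
  -- The pullback of `g` and `p` is a product, because `p` lifts along `g`.
  have hgf : ∀ x, g (f x) = 0 := hfg.apply_apply_eq_zero
  obtain ⟨p', hp'⟩ := Module.projective_lifting_property g p hg
  have hgp : ∀ x, g (p' x) = p x := fun x => LinearMap.congr_fun hp' x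
  let c : (X × (Fin r → Q)) →ₗ[Q] Y := f.coprod p'
  have hXP : IsFPn Q k (X × (Fin r → Q)) := by
    have h1 : ∀ w : LinearMap.ker p, ∃ x, f x = - p' w.1 := fun w =>
      (hfg _).1 (by rw [map_neg, hgp, LinearMap.mem_ker.1 w.2, neg_zero])
    choose s hs using h1
    let s' : LinearMap.ker p →ₗ[Q] X :=
      { toFun := s
        map_add' := fun a b => hf (by simp only [hs, map_add, Submodule.coe_add]; abel)
        map_smul' := fun a b => hf (by simp [hs]) }
    refine ext (s'.prod (LinearMap.ker p).subtype) c ?_ ?_ ?_ hpk hY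
    · intro a b hab
      exact Subtype.ext (congrArg Prod.snd hab)
    · intro y
      obtain ⟨v, hv⟩ := hp (g y)
      obtain ⟨x, hx⟩ := (hfg (y - p' v)).1 (by rw [map_sub, hgp, hv, sub_self])
      exact ⟨(x, v), by simp [c, hx]⟩
    · rintro ⟨x, v⟩
      constructor
      · intro h
        have h' : f x + p' v = 0 := by simpa [c] using h
        have hv : p v = 0 := by
          have := congrArg g h'
          simpa [hgf, hgp] using this
        refine ⟨⟨v, hv⟩, Prod.ext (hf ?_) rfl⟩
        change f (s _) = f x
        rw [hs, eq_neg_of_add_eq_zero_left h']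
      · rintro ⟨w, hw⟩
        rw [← hw]
        change f (s w) + p' w.1 = 0
        rw [hs, neg_add_cancel]
  exact quotient' (LinearMap.inr Q X _) (LinearMap.fst Q X _) LinearMap.inr_injective
    LinearMap.fst_surjective Function.Exact.inr_fst (fun k => finFree k r) hXP

end IsFPn

/-- `N` has a resolution by finite free modules. -/
def IsFPInfty (Q : Type u) [CommRing Q] (N : Type u) [AddCommGroup N] [Module Q N] : Prop :=
  ∀ k, IsFPn Q k N

lemma isResolvingClass_isFPInfty : IsResolvingClass (Q := Q) (fun N _ _ => IsFPInfty Q N) where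
  of_subsingleton _ _ _ _ := IsFPn.of_subsingleton
  ext f g hf hg hfg hX hZ k := IsFPn.ext f g hf hg hfg (hX k) (hZ k)
  ker f g hf hg hfg hY hZ k := IsFPn.ker f g hf hg hfg (hY k) (hZ (k + 1))

/-- The projective dimension of `N` is less than `k`. -/
def IsPDLT (Q : Type u) [CommRing Q] (k : ℕ) (N : Type u) [AddCommGroup N] [Module Q N] : Prop :=
  HasProjectiveDimensionLT (ModuleCat.of Q N) k

section PDLT

variable {X Y Z : Type u} [AddCommGroup X] [Module Q X] [AddCommGroup Y] [Module Q Y]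
    [AddCommGroup Z] [Module Q Z]

lemma IsPDLT.mono {k l : ℕ} (h : IsPDLT Q k X) (hkl : k ≤ l) : IsPDLT Q l X := by
  have : HasProjectiveDimensionLT (ModuleCat.of Q X) k := h
  exact hasProjectiveDimensionLT_of_ge _ k l hkl

lemma isPDLT_one_iff : IsPDLT Q 1 X ↔ Module.Projective Q X :=
  projective_iff_hasProjectiveDimensionLT_one.symm.trans
    (IsProjective.iff_projective X).symm

lemma shortExact_of_linearMap (f : X →ₗ[Q] Y) (g : Y →ₗ[Q] Z) (hf : Function.Injective f)
    (hg : Function.Surjective g) (hfg : Function.Exact f g) :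
    (ShortComplex.mk (ModuleCat.ofHom f) (ModuleCat.ofHom g) (by
      ext x; exact hfg.apply_apply_eq_zero x)).ShortExact where
  exact := (ShortComplex.ShortExact.moduleCat_exact_iff_function_exact _).2 hfg
  mono_f := (ModuleCat.mono_iff_injective _).2 hf
  epi_g := (ModuleCat.epi_iff_surjective _).2 hg

lemma IsPDLT.ker {k : ℕ} (f : X →ₗ[Q] Y) (g : Y →ₗ[Q] Z) (hf : Function.Injective f)
    (hg : Function.Surjective g) (hfg : Function.Exact f g)
    (hY : IsPDLT Q k Y) (hZ : IsPDLT Q (k + 1) Z) : IsPDLT Q k X :=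
  (shortExact_of_linearMap f g hf hg hfg).hasProjectiveDimensionLT_X₁ k hY hZ

lemma IsPDLT.quotient {k : ℕ} (f : X →ₗ[Q] Y) (g : Y →ₗ[Q] Z) (hf : Function.Injective f)
    (hg : Function.Surjective g) (hfg : Function.Exact f g)
    (hX : IsPDLT Q k X) (hY : IsPDLT Q (k + 1) Y) : IsPDLT Q (k + 1) Z :=
  (shortExact_of_linearMap f g hf hg hfg).hasProjectiveDimensionLT_X₃ k hX hY

lemma isResolvingClass_isPDLT (k : ℕ) : IsResolvingClass (Q := Q) (fun N _ _ => IsPDLT Q k N) where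
  of_subsingleton N _ _ _ := by
    have : HasProjectiveDimensionLT (ModuleCat.of Q N) 0 :=
      (ModuleCat.isZero_of_subsingleton (ModuleCat.of Q N)).hasProjectiveDimensionLT_zero
    exact hasProjectiveDimensionLT_of_ge _ 0 k k.zero_le
  ext f g hf hg hfg hX hZ :=
    (shortExact_of_linearMap f g hf hg hfg).hasProjectiveDimensionLT_X₂ k hX hZ
  ker f g hf hg hfg hY hZ := IsPDLT.ker f g hf hg hfg hY (hZ.mono k.le_succ)

end PDLT

/-- A finite projective resolution bounds the projective dimension. -/
lemma exists_isPDLT_of_hasFiniteProjDim {N : Type u} [AddCommGroup N] [Module Q N]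
    (h : HasFiniteProjDim Q N) : ∃ k, IsPDLT Q k N := by
  obtain ⟨R, hR⟩ := h
  have hG : ∀ k i, IsPDLT Q (k + 1) (R.G i) := fun k i =>
    (isPDLT_one_iff.2 (hR i)).mono (Nat.le_add_left 1 k)
  have key : ∀ k i, R.len < i + k → IsPDLT Q (k + 1) (LinearMap.range (R.d i)) := by
    intro k
    induction k with
    | zero =>
      intro i hi
      have := R.bounded (i + 1) (by omega)
      have : Subsingleton (LinearMap.range (R.d i)) := by
        refine ⟨?_⟩
        rintro ⟨_, x, rfl⟩ ⟨_, y, rfl⟩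
        rw [Subsingleton.elim x y]
      exact (isResolvingClass_isPDLT _).of_subsingleton _
    | succ k ih =>
      intro i hi
      refine IsPDLT.quotient (LinearMap.range (R.d (i + 1))).subtype (R.d i).rangeRestrict
        Subtype.val_injective (R.d i).surjective_rangeRestrict ?_ (ih (i + 1) (by omega)) (hG _ _)
      intro x
      rw [← R.exact_d i |>.linearMap_ker_eq]
      simp [Subtype.ext_iff]
  refine ⟨R.len + 1 + 1 + 1, IsPDLT.quotient (LinearMap.range (R.d 0)).subtype R.aug
    Subtype.val_injective R.aug_surj ?_ (key (R.len + 1) 0 (by omega)) (hG _ _)⟩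
  intro x
  rw [← R.exact_aug.linearMap_ker_eq]
  simp

/-- The quotient by a weakly regular sequence has a finite resolution by finite free modules. -/
lemma quotient_weaklyRegular (rs : List Q) (h : RingTheory.Sequence.IsWeaklyRegular Q rs) :
    IsFPInfty Q (Q ⧸ (Ideal.ofList rs • ⊤ : Submodule Q Q)) ∧
      ∃ k, IsPDLT Q k (Q ⧸ (Ideal.ofList rs • ⊤ : Submodule Q Q)) := by
  suffices H : ∀ i ≤ rs.length, IsFPInfty Q (Q ⧸ (Ideal.ofList (rs.take i) • ⊤ : Submodule Q Q)) ∧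
      ∃ k, IsPDLT Q k (Q ⧸ (Ideal.ofList (rs.take i) • ⊤ : Submodule Q Q)) by
    have := H rs.length le_rfl
    rwa [List.take_length] at this
  intro i
  induction i with
  | zero =>
    intro _
    have e : Q ≃ₗ[Q] (Q ⧸ (Ideal.ofList (rs.take 0) • ⊤ : Submodule Q Q)) :=
      (Submodule.quotEquivOfEqBot _ (by simp)).symm
    refine ⟨isResolvingClass_isFPInfty.of_equiv ((LinearEquiv.funUnique (Fin 1) Q Q).trans e)
      (fun k => IsFPn.finFree k 1), 1, (isResolvingClass_isPDLT 1).of_equiv e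
        (isPDLT_one_iff.2 inferInstance)⟩
  | succ i ih =>
    intro hi
    obtain ⟨h1, k, h2⟩ := ih (by omega)
    have hreg := h.regular_mod_prev i (by omega)
    have hle : Ideal.ofList (rs.take i) • (⊤ : Submodule Q Q) ≤
        Ideal.ofList (rs.take (i + 1)) • (⊤ : Submodule Q Q) := by
      rw [← List.take_concat_get' rs i (by omega), Ideal.ofList_append]
      exact Submodule.smul_mono_left le_sup_left
    let f : (Q ⧸ (Ideal.ofList (rs.take i) • ⊤ : Submodule Q Q)) →ₗ[Q]
      (Q ⧸ (Ideal.ofList (rs.take i) • ⊤ : Submodule Q Q)) := LinearMap.lsmul Q _ rs[i]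
    have hf : Function.Injective f := hreg
    have hg := Submodule.factor_surjective hle
    have hfg : Function.Exact f (Submodule.factor hle) := by
      intro y
      obtain ⟨y, rfl⟩ := Submodule.Quotient.mk_surjective _ y
      have h3 : Ideal.ofList (rs.take (i + 1)) • (⊤ : Submodule Q Q) =
          Ideal.ofList (rs.take i) • (⊤ : Submodule Q Q) ⊔ Ideal.span {rs[i]} := by
        rw [← List.take_concat_get' rs i (by omega), Ideal.ofList_append]
        simp
      change (Submodule.Quotient.mk y = 0) ↔ _
      rw [Submodule.Quotient.mk_eq_zero, h3, Submodule.mem_sup]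
      constructor
      · rintro ⟨a, ha, b, hb, rfl⟩
        obtain ⟨c, rfl⟩ := Ideal.mem_span_singleton'.1 hb
        refine ⟨Submodule.Quotient.mk c, ?_⟩
        change Submodule.Quotient.mk (rs[i] • c) = _
        rw [Submodule.Quotient.eq]
        have : rs[i] • c - (a + c * rs[i]) = -a := by simp only [smul_eq_mul]; ring
        rw [this]
        exact neg_mem ha
      · rintro ⟨c, hc⟩
        obtain ⟨c, rfl⟩ := Submodule.Quotient.mk_surjective _ c
        change Submodule.Quotient.mk (rs[i] • c) = _ at hc
        rw [Submodule.Quotient.eq] at hc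
        exact ⟨_, neg_mem hc, c * rs[i], Ideal.mem_span_singleton'.2 ⟨c, rfl⟩, by
          simp only [smul_eq_mul]; ring⟩
    exact ⟨fun k => IsFPn.quotient' f _ hf hg hfg h1 (h1 k), k + 1,
      IsPDLT.quotient f _ hf hg hfg h2 (h2.mono k.le_succ)⟩

end Syzygies

section Complexes

lemma Cx.d_apply_eq_zero_of_ne (C : Cx A) {i j : ℤ} (h : j + 1 ≠ i) (x : C.X i) :
    C.d i j x = 0 := by
  rw [C.shape i j h]; rfl

lemma Cx.d_d_apply (C : Cx A) (i j k : ℤ) (x : C.X i) : C.d j k (C.d i j x) = 0 :=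
  LinearMap.congr_fun (C.dsq i j k) x

lemma CxHom.comm_apply {C D : Cx A} (φ : CxHom C D) (i j : ℤ) (x : C.X i) :
    D.d i j (φ.f i x) = φ.f j (C.d i j x) :=
  LinearMap.congr_fun (φ.comm i j) x

lemma Cx.mem_cycles_iff (C : Cx A) {i j : ℤ} (h : j + 1 = i) (x : C.X i) :
    x ∈ C.cycles i ↔ C.d i j x = 0 := by
  obtain rfl : j = i - 1 := by omega
  rfl

lemma Cx.d_apply_of_mem_cycles (C : Cx A) {i : ℤ} {x : C.X i} (hx : x ∈ C.cycles i) (k : ℤ) :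
    C.d i k x = 0 := by
  by_cases h : k + 1 = i
  · exact (C.mem_cycles_iff h x).1 hx
  · exact C.d_apply_eq_zero_of_ne h x

lemma Cx.d_mem_cycles (C : Cx A) (i j : ℤ) (x : C.X i) : C.d i j x ∈ C.cycles j :=
  C.d_d_apply i j _ x

lemma CxHom.map_mem_cycles {C D : Cx A} (φ : CxHom C D) {i : ℤ} {x : C.X i}
    (hx : x ∈ C.cycles i) : φ.f i x ∈ D.cycles i := by
  change D.d _ _ _ = 0
  rw [φ.comm_apply, C.d_apply_of_mem_cycles hx, map_zero]

/-- The composite of two chain maps. -/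
def CxHom.comp {C D E : Cx A} (ψ : CxHom D E) (φ : CxHom C D) : CxHom C E where
  f i := (ψ.f i).comp (φ.f i)
  comm i j := by
    ext x
    simp only [LinearMap.comp_apply, CxHom.comm_apply]

/-- The complex is exact in degree `i`. -/
def Cx.ExactAt (C : Cx A) (i : ℤ) : Prop :=
  ∀ x ∈ C.cycles i, ∃ y, C.d (i + 1) i y = x

lemma Cx.exactAt_iff (C : Cx A) (i : ℤ) : C.ExactAt i ↔ Subsingleton (C.homology i) := by
  have : Subsingleton (C.homology i) ↔ (C.bnd i).comap (C.cycles i).subtype = ⊤ :=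
    Submodule.Quotient.subsingleton_iff
  rw [this, Submodule.eq_top_iff']
  exact ⟨fun h x => h x.1 x.2, fun h x hx => h ⟨x, hx⟩⟩

lemma CxHom.homologyMap_mk {C D : Cx A} (φ : CxHom C D) (i : ℤ) (x : C.cycles i) :
    φ.homologyMap i (Submodule.Quotient.mk x) =
      Submodule.Quotient.mk ⟨φ.f i x.1, φ.map_mem_cycles x.2⟩ := rfl

lemma CxHom.homologyMap_injective_iff {C D : Cx A} (φ : CxHom C D) (i : ℤ) :
    Function.Injective (φ.homologyMap i) ↔ ∀ x ∈ C.cycles i, ∀ y, φ.f i x = D.d (i + 1) i y →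
      ∃ z, C.d (i + 1) i z = x := by
  rw [injective_iff_map_eq_zero]
  constructor
  · intro h x hx y hy
    have h0 := h (Submodule.Quotient.mk ⟨x, hx⟩) (by
      rw [homologyMap_mk]
      exact (Submodule.Quotient.mk_eq_zero _).2 ⟨y, hy.symm⟩)
    exact (Submodule.Quotient.mk_eq_zero _).1 h0
  · intro h a ha
    obtain ⟨⟨x, hx⟩, rfl⟩ := Submodule.Quotient.mk_surjective _ a
    rw [homologyMap_mk] at ha
    obtain ⟨y, hy⟩ := (Submodule.Quotient.mk_eq_zero _).1 ha
    exact (Submodule.Quotient.mk_eq_zero _).2 (h x hx y hy.symm)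

lemma CxHom.homologyMap_surjective_iff {C D : Cx A} (φ : CxHom C D) (i : ℤ) :
    Function.Surjective (φ.homologyMap i) ↔ ∀ y ∈ D.cycles i, ∃ x ∈ C.cycles i, ∃ w,
      y = φ.f i x + D.d (i + 1) i w := by
  constructor
  · intro h y hy
    obtain ⟨a, ha⟩ := h (Submodule.Quotient.mk ⟨y, hy⟩)
    obtain ⟨⟨x, hx⟩, rfl⟩ := Submodule.Quotient.mk_surjective _ a
    rw [homologyMap_mk] at ha
    obtain ⟨w, hw⟩ := (Submodule.Quotient.eq _).1 ha.symm
    exact ⟨x, hx, w, by rw [hw]; simp⟩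
  · intro h b
    obtain ⟨⟨y, hy⟩, rfl⟩ := Submodule.Quotient.mk_surjective _ b
    obtain ⟨x, hx, w, rfl⟩ := h y hy
    refine ⟨Submodule.Quotient.mk ⟨x, hx⟩, ?_⟩
    rw [homologyMap_mk]
    exact ((Submodule.Quotient.eq ((D.bnd i).comap (D.cycles i).subtype)).2 ⟨w, by simp⟩).symm

lemma CxHom.IsQuasiIso.comp {C D E : Cx A} {ψ : CxHom D E} {φ : CxHom C D}
    (hψ : ψ.IsQuasiIso) (hφ : φ.IsQuasiIso) : (ψ.comp φ).IsQuasiIso := by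
  intro i
  have h : (ψ.comp φ).homologyMap i = (ψ.homologyMap i).comp (φ.homologyMap i) := by
    ext a
    obtain ⟨x, rfl⟩ := Submodule.Quotient.mk_surjective _ a
    rfl
  rw [h, LinearMap.coe_comp]
  exact (hψ i).comp (hφ i)

/-- Exactness of the mapping cone of `φ`, spelled out on elements. -/
lemma CxHom.isQuasiIso_iff {C D : Cx A} (φ : CxHom C D) :
    φ.IsQuasiIso ↔ ∀ i, ∀ x ∈ C.cycles i, ∀ y : D.X (i + 1), φ.f i x = D.d (i + 1) i y →
      ∃ (x' : C.X (i + 1)) (y' : D.X (i + 1 + 1)),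
        C.d (i + 1) i x' = x ∧ y = φ.f (i + 1) x' + D.d (i + 1 + 1) (i + 1) y' := by
  constructor
  · intro h i x hx y hy
    obtain ⟨z, rfl⟩ := (φ.homologyMap_injective_iff i).1 (h i).1 x hx y hy
    obtain ⟨u, hu, w, hw⟩ := (φ.homologyMap_surjective_iff (i + 1)).1 (h (i + 1)).2
      (y - φ.f (i + 1) z) (by
        rw [D.mem_cycles_iff rfl, map_sub, ← hy, φ.comm_apply, sub_self])
    refine ⟨z + u, w, ?_, ?_⟩
    · rw [map_add, C.d_apply_of_mem_cycles hu, add_zero]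
    · rw [map_add, add_assoc, ← hw]; abel
  · intro h i
    refine ⟨(φ.homologyMap_injective_iff i).2 fun x hx y hy => ?_,
      (φ.homologyMap_surjective_iff i).2 ?_⟩
    · obtain ⟨x', _, hx', _⟩ := h i x hx y hy
      exact ⟨x', hx'⟩
    · obtain ⟨i, rfl⟩ : ∃ j, i = j + 1 := ⟨i - 1, by omega⟩
      intro y hy
      obtain ⟨x', y', hx', hy'⟩ := h i 0 (zero_mem _) y (by
        rw [map_zero, D.d_apply_of_mem_cycles hy])
      exact ⟨x', (C.mem_cycles_iff rfl _).2 hx', y', hy'⟩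

variable {Q : Type u} [CommRing Q]

/-- The part of `N` placed in degree `i`, when `N` is viewed as concentrated in degree `m`. -/
def placedIn (N : Type u) [AddCommGroup N] [Module Q N] (m i : ℤ) : Submodule Q N where
  carrier := {v | i ≠ m → v = 0}
  add_mem' ha hb h := by rw [ha h, hb h, add_zero]
  zero_mem' _ := rfl
  smul_mem' a v hv h := by rw [hv h, smul_zero]

/-- The complex obtained from `P` by adding `N` in degree `m`, with differential `h` on `N`. -/
def Cx.attach (P : Cx Q) (N : Type u) [AddCommGroup N] [Module Q N] (m : ℤ)
    (h : ∀ j, N →ₗ[Q] P.X j) (hs : ∀ j, j + 1 ≠ m → h j = 0)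
    (hd : ∀ j k v, P.d j k (h j v) = 0) : Cx Q where
  X i := ModuleCat.of Q (P.X i × placedIn (Q := Q) N m i)
  d i j := ((P.d i j).coprod ((h j).comp (placedIn N m i).subtype)).prod 0
  shape i j hij := by
    refine LinearMap.ext fun ⟨p, v, hv⟩ => Prod.ext ?_ rfl
    change P.d i j p + h j v = 0
    rw [P.d_apply_eq_zero_of_ne hij, zero_add]
    by_cases him : i = m
    · rw [hs j (by omega)]; rfl
    · rw [hv him, map_zero]
  dsq i j k := by
    refine LinearMap.ext fun ⟨p, v, hv⟩ => Prod.ext ?_ rfl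
    change P.d j k (P.d i j p + h j v) + h k 0 = 0
    rw [map_add, P.d_d_apply, hd, map_zero, add_zero, add_zero]

lemma Cx.exists_attach {P E : Cx Q} (φ : CxHom P E) (i : ℤ) [Subsingleton (P.X (i + 1))]
    (N : Type u) [AddCommGroup N] [Module Q N] (h : N →ₗ[Q] P.X i) (e : N →ₗ[Q] E.X (i + 1))
    (hd : ∀ v, h v ∈ P.cycles i) (hφ : ∀ v, φ.f i (h v) = E.d (i + 1) i (e v)) :
    ∃ (P' : Cx Q) (φ' : CxHom P' E) (α : ∀ j, P.X j →ₗ[Q] P'.X j) (β : N →ₗ[Q] P'.X (i + 1)),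
      (∀ j k x, P'.d j k (α j x) = α k (P.d j k x)) ∧
      (∀ j x, φ'.f j (α j x) = φ.f j x) ∧
      (∀ j, Function.Injective (α j)) ∧
      (∀ j, j ≠ i + 1 → Function.Surjective (α j)) ∧
      Function.Bijective β ∧
      (∀ v, P'.d (i + 1) i (β v) = α i (h v)) ∧
      (∀ v, φ'.f (i + 1) (β v) = e v) := by
  let h' : ∀ j, N →ₗ[Q] P.X j := Pi.single i h
  have hh : h' i = h := Pi.single_eq_same _ _
  have hh0 : ∀ j, j ≠ i → h' j = 0 := fun j hj => Pi.single_eq_of_ne hj _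
  let e' : ∀ j, N →ₗ[Q] E.X j := Pi.single (i + 1) e
  have he : e' (i + 1) = e := Pi.single_eq_same _ _
  have hd' : ∀ j k v, P.d j k (h' j v) = 0 := by
    intro j k v
    by_cases hj : j = i
    · subst hj
      rw [hh]
      exact P.d_apply_of_mem_cycles (hd v) k
    · rw [hh0 j hj, LinearMap.zero_apply, map_zero]
  have hφ' : ∀ j k, ∀ v ∈ placedIn (Q := Q) N (i + 1) j, E.d j k (e' j v) = φ.f k (h' k v) := by
    intro j k v hv
    by_cases hj : j = i + 1
    · subst hj
      by_cases hk : k = i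
      · subst hk
        rw [hh, he, hφ]
      · rw [hh0 k hk, E.d_apply_eq_zero_of_ne (by omega), LinearMap.zero_apply, map_zero]
    · rw [hv hj]; simp only [map_zero]
  let P' := P.attach N (i + 1) h' (fun j hj => hh0 j (by omega)) hd'
  let φ' : CxHom P' E :=
    { f := fun j => (φ.f j).coprod ((e' j).comp (placedIn N (i + 1) j).subtype)
      comm := fun j k => by
        refine LinearMap.ext fun ⟨p, v, hv⟩ => ?_
        change E.d j k (φ.f j p + e' j v) = φ.f k (P.d j k p + h' k v) + e' k 0
        rw [map_add, map_add, φ.comm_apply, hφ' j k v hv, map_zero, add_zero] }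
  refine ⟨P', φ', fun j => LinearMap.inl Q _ _,
    (LinearMap.inr Q _ _).comp (LinearMap.id.codRestrict (placedIn N (i + 1) (i + 1))
      fun v hv => absurd rfl hv), ?_, ?_, ?_, ?_, ⟨?_, ?_⟩, ?_, ?_⟩
  · intro j k x
    refine Prod.ext ?_ rfl
    change P.d j k x + h' k 0 = P.d j k x
    rw [map_zero, add_zero]
  · intro j x
    change φ.f j x + e' j 0 = φ.f j x
    rw [map_zero, add_zero]
  · exact fun j => LinearMap.inl_injective
  · rintro j hj ⟨p, v, hv⟩
    exact ⟨p, Prod.ext rfl (Subtype.ext (hv hj).symm)⟩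
  · intro v w hvw
    exact congrArg Subtype.val (congrArg Prod.snd hvw)
  · rintro ⟨p, v, hv⟩
    exact ⟨v, Prod.ext (Subsingleton.elim _ _) rfl⟩
  · intro v
    refine Prod.ext ?_ rfl
    change P.d (i + 1) i 0 + h' i v = h v
    rw [map_zero, zero_add, hh]
  · intro v
    change φ.f (i + 1) 0 + e' (i + 1) v = e v
    rw [map_zero, zero_add, he]

/-- The pairs of a cycle in `P` and an element of `E` bounding its image. -/
def CxHom.pairs {P E : Cx Q} (φ : CxHom P E) (i : ℤ) : Submodule Q (P.X i × E.X (i + 1)) where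
  carrier := {x | x.1 ∈ P.cycles i ∧ φ.f i x.1 = E.d (i + 1) i x.2}
  add_mem' ha hb := ⟨add_mem ha.1 hb.1, by
    rw [Prod.fst_add, Prod.snd_add, map_add, map_add, ha.2, hb.2]⟩
  zero_mem' := ⟨zero_mem _, by simp⟩
  smul_mem' a x hx := ⟨Submodule.smul_mem _ a hx.1, by
    rw [Prod.smul_fst, Prod.smul_snd, map_smul, map_smul, hx.2]⟩

/-- Every pair in `φ.pairs i` is the image of an element of `P` of degree `i + 1`. -/
def CxHom.FillsAt {P E : Cx Q} (φ : CxHom P E) (i : ℤ) : Prop :=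
  ∀ x ∈ φ.pairs i, ∃ p : P.X (i + 1), P.d (i + 1) i p = x.1 ∧ φ.f (i + 1) p = x.2

lemma IsResolvingClass.pairs {𝒞 : ∀ (N : Type u) [AddCommGroup N] [Module Q N], Prop}
    (h𝒞 : IsResolvingClass 𝒞) {P E : Cx Q} (φ : CxHom P E) (n₀ : ℤ)
    (hP : ∀ j, 𝒞 (P.X j)) (hE : ∀ j, 𝒞 (E.X j))
    (hP₀ : ∀ j < n₀, Subsingleton (P.X j)) (hE₀ : ∀ j < n₀, Subsingleton (E.X j))
    (i : ℤ) (hφ : ∀ j < i, φ.FillsAt j) : 𝒞 (φ.pairs i) := by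
  suffices H : ∀ m : ℕ, ∀ i, i + 1 < n₀ + m → (∀ j < i, φ.FillsAt j) → 𝒞 (φ.pairs i) from
    H (i + 2 - n₀).toNat i (by omega) hφ
  clear hφ i
  intro m
  induction m with
  | zero =>
    intro i hi _
    have := hP₀ i (by omega)
    have := hE₀ (i + 1) (by omega)
    exact h𝒞.of_subsingleton _
  | succ m ih =>
    intro i hi hφ
    obtain ⟨i, rfl⟩ : ∃ j, i = j + 1 := ⟨i - 1, by omega⟩
    let g : (P.X (i + 1) × E.X (i + 1 + 1)) →ₗ[Q] (P.X i × E.X (i + 1)) :=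
      ((P.d (i + 1) i).comp (LinearMap.fst Q _ _)).prod
        ((φ.f (i + 1)).comp (LinearMap.fst Q _ _) -
          (E.d (i + 1 + 1) (i + 1)).comp (LinearMap.snd Q _ _))
    have hg : ∀ x, g x ∈ φ.pairs i := by
      intro x
      refine ⟨P.d_mem_cycles _ _ _, ?_⟩
      change φ.f i (P.d (i + 1) i x.1) =
        E.d (i + 1) i (φ.f (i + 1) x.1 - E.d (i + 1 + 1) (i + 1) x.2)
      rw [map_sub, E.d_d_apply, sub_zero, φ.comm_apply]
    refine h𝒞.ker (φ.pairs (i + 1)).subtype (g.codRestrict _ hg) Subtype.val_injective ?_ ?_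
      (h𝒞.prod (hP _) (hE _)) (ih i (by push_cast at hi; omega) fun j hj => hφ j (by omega))
    · rintro ⟨x, hx⟩
      obtain ⟨p, hp1, hp2⟩ := hφ i (by omega) x hx
      refine ⟨(p, 0), Subtype.ext (Prod.ext hp1 ?_)⟩
      change φ.f (i + 1) p - E.d _ _ 0 = x.2
      rw [map_zero, sub_zero, hp2]
    · intro x
      rw [Submodule.coe_subtype, Subtype.range_coe]
      constructor
      · intro h
        have h' : g x = 0 := congrArg Subtype.val h
        exact ⟨(P.mem_cycles_iff rfl _).2 (congrArg Prod.fst h'),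
          sub_eq_zero.1 (congrArg Prod.snd h')⟩
      · rintro ⟨h1, h2⟩
        exact Subtype.ext (Prod.ext ((P.mem_cycles_iff rfl _).1 h1) (sub_eq_zero.2 h2))

/-- Partial resolution of a bounded below complex of modules of type `FP∞` by finite projective
modules. -/
lemma Cx.exists_partial_resolution (E : Cx Q) (n₀ : ℤ)
    (hE₀ : ∀ j < n₀, Subsingleton (E.X j)) (hE : ∀ j, IsFPInfty Q (E.X j)) (m : ℕ) :
    ∃ (P : Cx Q) (φ : CxHom P E),
      (∀ j, j < n₀ ∨ n₀ - 1 + m < j → Subsingleton (P.X j)) ∧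
      (∀ j, Module.Projective Q (P.X j) ∧ IsFPInfty Q (P.X j)) ∧
      (∀ j < n₀ - 1 + m, φ.FillsAt j) := by
  induction m with
  | zero =>
    refine ⟨⟨fun _ => ModuleCat.of Q PUnit, 0, fun _ _ _ => rfl, fun _ _ _ => rfl⟩,
      ⟨fun _ => 0, fun _ _ => by rw [LinearMap.comp_zero, LinearMap.zero_comp]⟩,
      fun j _ => inferInstanceAs (Subsingleton PUnit),
      fun j => ⟨inferInstanceAs (Module.Projective Q PUnit.{u + 1}),
        isResolvingClass_isFPInfty.of_subsingleton PUnit⟩, ?_⟩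
    rintro j hj x -
    have := hE₀ (j + 1) (by simp at hj; omega)
    exact ⟨0, rfl, Subsingleton.elim _ _⟩
  | succ m ih =>
    obtain ⟨P, φ, hP₀, hP, hφ⟩ := ih
    set i : ℤ := n₀ - 1 + m with hi
    have := hP₀ (i + 1) (by omega)
    have hV := isResolvingClass_isFPInfty.pairs φ n₀ (fun j => (hP j).2) hE
      (fun j hj => hP₀ j (Or.inl hj)) hE₀ i hφ
    obtain ⟨r, q, hq, -⟩ := hV 1
    obtain ⟨P', φ', α, β, h1, h2, h3, h4, h5, h6, h7⟩ := Cx.exists_attach φ i (Fin r → Q)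
      ((LinearMap.fst Q _ _).comp ((φ.pairs i).subtype.comp q))
      ((LinearMap.snd Q _ _).comp ((φ.pairs i).subtype.comp q))
      (fun v => (q v).2.1) (fun v => (q v).2.2)
    have hα : ∀ j, j ≠ i + 1 → ∃ ε : P.X j ≃ₗ[Q] P'.X j, ∀ x, ε x = α j x := fun j hj =>
      ⟨LinearEquiv.ofBijective (α j) ⟨h3 j, h4 j hj⟩, fun _ => rfl⟩
    refine ⟨P', φ', ?_, ?_, ?_⟩
    · intro j hj
      have := hP₀ j (by push_cast at hj; omega)
      exact (h4 j (by push_cast at hj; omega)).subsingleton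
    · intro j
      by_cases hj : j = i + 1
      · subst hj
        let ε := LinearEquiv.ofBijective β h5
        exact ⟨Module.Projective.of_equiv ε,
          isResolvingClass_isFPInfty.of_equiv ε fun k => IsFPn.finFree k r⟩
      · obtain ⟨ε, -⟩ := hα j hj
        have := (hP j).1
        exact ⟨Module.Projective.of_equiv ε, isResolvingClass_isFPInfty.of_equiv ε (hP j).2⟩
    · rintro j hj ⟨x, y⟩ ⟨hx, hxy⟩
      obtain ⟨x, rfl⟩ := h4 j (by push_cast at hj; omega) x
      simp only [h2] at hx hxy ⊢
      have hx' : x ∈ P.cycles j := by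
        apply h3 (j - 1)
        rw [← h1, P'.d_apply_of_mem_cycles hx, map_zero]
      obtain hj | rfl : j < i ∨ j = i := by push_cast at hj; omega
      · obtain ⟨p, hp1, hp2⟩ := hφ j hj (x, y) ⟨hx', hxy⟩
        exact ⟨α _ p, by rw [h1, hp1], by rw [h2, hp2]⟩
      · obtain ⟨v, hv⟩ := hq ⟨(x, y), hx', hxy⟩
        exact ⟨β v, by rw [h6]; simp [hv], by rw [h7]; simp [hv]⟩

end Complexes

section Perfect

variable {Q : Type u} [CommRing Q]

lemma Cx.cycles_succ_class {𝒞 : ∀ (N : Type u) [AddCommGroup N] [Module Q N], Prop}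
    (h𝒞 : IsResolvingClass 𝒞) (C : Cx Q) (i : ℤ) (hi : C.ExactAt i)
    (hC : 𝒞 (C.X (i + 1))) (hZ : 𝒞 (C.cycles i)) : 𝒞 (C.cycles (i + 1)) := by
  refine h𝒞.ker (C.cycles (i + 1)).subtype
    ((C.d (i + 1) i).codRestrict (C.cycles i) (C.d_mem_cycles _ _)) Subtype.val_injective ?_ ?_ hC hZ
  · rintro ⟨x, hx⟩
    obtain ⟨y, hy⟩ := hi x hx
    exact ⟨y, Subtype.ext hy⟩
  · intro x
    rw [Submodule.coe_subtype, Subtype.range_coe, SetLike.mem_coe, C.mem_cycles_iff rfl]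
    exact Subtype.ext_iff

lemma Cx.isPDLT_cycles_succ (C : Cx Q) (i : ℤ) (hi : C.ExactAt i) {k : ℕ}
    (hC : IsPDLT Q k (C.X (i + 1))) (hZ : IsPDLT Q (k + 1) (C.cycles i)) :
    IsPDLT Q k (C.cycles (i + 1)) := by
  refine IsPDLT.ker (C.cycles (i + 1)).subtype
    ((C.d (i + 1) i).codRestrict (C.cycles i) (C.d_mem_cycles _ _)) Subtype.val_injective ?_ ?_ hC hZ
  · rintro ⟨x, hx⟩
    obtain ⟨y, hy⟩ := hi x hx
    exact ⟨y, Subtype.ext hy⟩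
  · intro x
    rw [Submodule.coe_subtype, Subtype.range_coe, SetLike.mem_coe, C.mem_cycles_iff rfl]
    exact Subtype.ext_iff

lemma CxHom.exactAt_of_fillsAt {P E : Cx Q} (φ : CxHom P E) (i : ℤ) (hE : E.ExactAt i)
    (hφ : φ.FillsAt i) : P.ExactAt i := by
  intro x hx
  obtain ⟨y, hy⟩ := hE _ (φ.map_mem_cycles hx)
  obtain ⟨p, hp, -⟩ := hφ (x, y) ⟨hx, hy.symm⟩
  exact ⟨p, hp⟩

/-- A bounded below complex of modules of type `FP∞` and bounded projective dimension, which is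
exact above degree `n` and whose cokernel in degree `n` has finite projective dimension, is
quasi-isomorphic to a perfect complex. -/
lemma Cx.hasFinitePD_of_cokernel (E : Cx Q) (n₀ n : ℤ) (hn : n₀ ≤ n)
    (hE₀ : ∀ j < n₀, Subsingleton (E.X j)) (hE : ∀ j, IsFPInfty Q (E.X j))
    (K : ℕ) (hK : 1 ≤ K) (hEK : ∀ j, IsPDLT Q K (E.X j)) (hex : ∀ i, n < i → E.ExactAt i)
    {M : Type u} [AddCommGroup M] [Module Q M] (π : E.X n →ₗ[Q] M) (hπ : Function.Surjective π)
    (hdπ : Function.Exact (E.d (n + 1) n) π) (hM : IsPDLT Q K M) : E.HasFinitePD := by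
  have hR := isResolvingClass_isPDLT (Q := Q) K
  have hZE : IsPDLT Q K (E.cycles (n + 1 + 1)) := by
    refine E.cycles_succ_class hR (n + 1) (hex _ (by omega)) (hEK _) ?_
    have hB : IsPDLT Q K (LinearMap.range (E.d (n + 1) n)) :=
      hR.of_equiv (LinearEquiv.ofEq _ _ hdπ.linearMap_ker_eq)
        (hR.ker_surjective π hπ (hEK n) hM)
    have hker := hR.ker_surjective _ (E.d (n + 1) n).surjective_rangeRestrict (hEK _) hB
    refine hR.of_equiv (LinearEquiv.ofEq _ _ ?_) hker
    ext x
    rw [E.mem_cycles_iff rfl, LinearMap.ker_rangeRestrict, LinearMap.mem_ker]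
  obtain ⟨P, φ, hP₀, hP, hφ⟩ := E.exists_partial_resolution n₀ hE₀ hE (n + 1 + K - (n₀ - 1)).toNat
  obtain ⟨i, hi, hi'⟩ : ∃ i : ℤ, i = n₀ - 1 + (n + 1 + K - (n₀ - 1)).toNat ∧ i = n + 1 + K :=
    ⟨_, rfl, by omega⟩
  rw [← hi] at hP₀ hφ
  have hPpd : ∀ j k, IsPDLT Q (k + 1) (P.X j) := fun j k =>
    (isPDLT_one_iff.2 (hP j).1).mono (Nat.le_add_left 1 k)
  have hPK : ∀ j, IsPDLT Q K (P.X j) := fun j => (isPDLT_one_iff.2 (hP j).1).mono hK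
  have hPex : ∀ j, n < j → j < i → P.ExactAt j := fun j hj hji =>
    φ.exactAt_of_fillsAt j (hex j hj) (hφ j hji)
  have hfst : ∀ j, n < j → ∀ x ∈ P.cycles j, ∃ y, (x, y) ∈ φ.pairs j := by
    intro j hj x hx
    obtain ⟨y, hy⟩ := hex j hj _ (φ.map_mem_cycles hx)
    exact ⟨y, hx, hy.symm⟩
  let pr : ∀ j, φ.pairs j →ₗ[Q] P.cycles j := fun j =>
    ((LinearMap.fst Q _ _).comp (φ.pairs j).subtype).codRestrict _ fun x => x.2.1
  have hpr : ∀ j, n < j → Function.Surjective (pr j) := by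
    rintro j hj ⟨x, hx⟩
    obtain ⟨y, hy⟩ := hfst j hj x hx
    exact ⟨⟨(x, y), hy⟩, rfl⟩
  have hZP : IsPDLT Q (K + 1) (P.cycles (n + 1)) := by
    have hV := hR.pairs φ n₀ hPK hEK (fun j hj => hP₀ j (Or.inl hj)) hE₀ (n + 1)
      fun j hj => hφ j (by omega)
    refine IsPDLT.quotient
      (((LinearMap.inr Q _ _).comp (E.cycles (n + 1 + 1)).subtype).codRestrict (φ.pairs (n + 1))
        fun y => ⟨zero_mem _, ?_⟩) (pr (n + 1)) ?_ (hpr _ (by omega)) ?_ hZE (hV.mono K.le_succ)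
    · change φ.f (n + 1) 0 = E.d (n + 1 + 1) (n + 1) y.1
      rw [map_zero, E.d_apply_of_mem_cycles y.2]
    · intro a b hab
      exact Subtype.ext (congrArg (fun z => z.1.2) hab)
    · rintro ⟨⟨x, y⟩, hx, hxy⟩
      constructor
      · intro h
        obtain rfl : x = 0 := congrArg Subtype.val h
        refine ⟨⟨y, (E.mem_cycles_iff rfl _).2 ?_⟩, rfl⟩
        rw [← hxy, map_zero]
      · rintro ⟨z, hz⟩
        have : (0 : P.X (n + 1)) = x := congrArg (fun z => z.1.1) hz
        exact Subtype.ext this.symm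
  have hdesc : ∀ m ≤ K, ∀ j : ℤ, j = n + 1 + m → IsPDLT Q (K - m + 1) (P.cycles j) := by
    intro m
    induction m with
    | zero =>
      intro _ j hj
      obtain rfl : j = n + 1 := by simpa using hj
      exact hZP
    | succ m ih =>
      intro hm j hj
      obtain ⟨j, rfl⟩ : ∃ l, j = l + 1 := ⟨j - 1, by omega⟩
      refine P.isPDLT_cycles_succ j (hPex j (by omega) (by omega)) (hPpd _ _) ?_
      have := ih (by omega) j (by push_cast at hj; omega)
      rwa [show K - m = K - (m + 1) + 1 by omega] at this
  have hproj : Module.Projective Q (P.cycles i) := by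
    have := hdesc K le_rfl i hi'
    rw [Nat.sub_self] at this
    exact isPDLT_one_iff.1 this
  have hfin : Module.Finite Q (P.cycles i) := by
    have := (isResolvingClass_isFPInfty.pairs φ n₀ (fun j => (hP j).2) hE
      (fun j hj => hP₀ j (Or.inl hj)) hE₀ i hφ 0).finite
    exact Module.Finite.of_surjective (pr i) (hpr i (by omega))
  obtain ⟨e, he⟩ := Module.projective_lifting_property (pr i) LinearMap.id (hpr i (by omega))
  have he' : ∀ v, (e v).1.1 = v.1 := fun v => congrArg Subtype.val (LinearMap.congr_fun he v)
  have := hP₀ (i + 1) (by omega)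
  obtain ⟨P', φ', α, β, h1, h2, h3, h4, h5, h6, h7⟩ := Cx.exists_attach φ i (P.cycles i)
    (P.cycles i).subtype ((LinearMap.snd Q _ _).comp ((φ.pairs i).subtype.comp e))
    (fun v => v.2) (fun v => by
      have := (e v).2.2
      rw [he'] at this
      exact this)
  have hcyc : ∀ j, ∀ x, α j x ∈ P'.cycles j → x ∈ P.cycles j := by
    intro j x hx
    apply h3 (j - 1)
    rw [← h1, P'.d_apply_of_mem_cycles hx, map_zero]
  have hfill : ∀ j < i, φ'.FillsAt j := by
    rintro j hj ⟨x, y⟩ ⟨hx, hxy⟩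
    obtain ⟨x, rfl⟩ := h4 j (by omega) x
    simp only [h2] at hx hxy ⊢
    obtain ⟨p, hp1, hp2⟩ := hφ j hj (x, y) ⟨hcyc j x hx, hxy⟩
    exact ⟨α _ p, by rw [h1, hp1], by rw [h2, hp2]⟩
  have hsub : ∀ j, j < n₀ ∨ i + 1 < j → Subsingleton (P'.X j) := by
    intro j hj
    have := hP₀ j (by omega)
    exact (h4 j (by omega)).subsingleton
  have hP'ex : ∀ j, i ≤ j → P'.ExactAt j := by
    intro j hj x hx
    obtain rfl | rfl | hj : j = i ∨ j = i + 1 ∨ i + 1 < j := by omega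
    · obtain ⟨x, rfl⟩ := h4 j (by omega) x
      exact ⟨β ⟨x, hcyc j x hx⟩, h6 _⟩
    · obtain ⟨v, rfl⟩ := h5.2 x
      have h0 : α i v.1 = 0 := (h6 v).symm.trans (P'.d_apply_of_mem_cycles hx i)
      obtain rfl : v = 0 := Subtype.ext (h3 i (h0.trans (map_zero _).symm))
      exact ⟨0, by rw [map_zero, map_zero]⟩
    · have := hsub j (Or.inr hj)
      exact ⟨0, Subsingleton.elim _ _⟩
  refine ⟨P', ⟨⟨n₀, i + 1, hsub⟩, fun j => ?_⟩, φ', fun j => ⟨?_, ?_⟩⟩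
  · by_cases hj : j = i + 1
    · subst hj
      let ε := LinearEquiv.ofBijective β h5
      exact ⟨Module.Finite.equiv ε, Module.Projective.of_equiv ε⟩
    · let ε := LinearEquiv.ofBijective (α j) ⟨h3 j, h4 j hj⟩
      have := (hP j).1
      have := ((hP j).2 0).finite
      exact ⟨Module.Finite.equiv ε, Module.Projective.of_equiv ε⟩
  · rw [φ'.homologyMap_injective_iff]
    intro x hx y hy
    by_cases hj : j < i
    · obtain ⟨p, hp, -⟩ := hfill j hj (x, y) ⟨hx, hy⟩
      exact ⟨p, hp⟩
    · exact hP'ex j (by omega) x hx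
  · rw [φ'.homologyMap_surjective_iff]
    intro y hy
    by_cases hj : j < i
    · obtain ⟨j, rfl⟩ : ∃ l, j = l + 1 := ⟨j - 1, by omega⟩
      obtain ⟨p, hp1, hp2⟩ := hfill j (by omega) (0, y) ⟨zero_mem _, by
        rw [map_zero, E.d_apply_of_mem_cycles hy]⟩
      exact ⟨p, (P'.mem_cycles_iff rfl _).2 hp1, 0, by rw [map_zero, add_zero, hp2]⟩
    · obtain ⟨w, hw⟩ := hex j (by omega) y hy
      exact ⟨0, zero_mem _, w, by rw [map_zero, zero_add, hw]⟩

end Perfect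

section BaseChange

variable {R : Type u} [CommRing R]

/-- The chain map induced by base change. -/
def CxHom.baseChange [Algebra A R] {C D : Cx A} (φ : CxHom C D) :
    CxHom (C.baseChange R) (D.baseChange R) where
  f i := (φ.f i).baseChange R
  comm i j := by
    change ((D.d i j).baseChange R).comp ((φ.f i).baseChange R) =
      ((φ.f j).baseChange R).comp ((C.d i j).baseChange R)
    rw [← LinearMap.baseChange_comp, φ.comm, LinearMap.baseChange_comp]

/-- The chain map induced by restriction of scalars. -/
def CxHom.restrict {Q : Type u} [CommRing Q] (g : Q →+* R) {C D : Cx R} (φ : CxHom C D) :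
    CxHom (C.restrict g) (D.restrict g) where
  f i :=
    letI : Module Q (C.X i) := Module.compHom _ g
    letI : Module Q (D.X i) := Module.compHom _ g
    { toFun := φ.f i
      map_add' := (φ.f i).map_add
      map_smul' := fun q x => (φ.f i).map_smul (g q) x }
  comm i j := by
    ext x
    exact φ.comm_apply i j x

lemma CxHom.IsQuasiIso.restrict {Q : Type u} [CommRing Q] (g : Q →+* R) {C D : Cx R}
    {φ : CxHom C D} (hφ : φ.IsQuasiIso) : (φ.restrict g).IsQuasiIso := by
  rw [CxHom.isQuasiIso_iff] at hφ ⊢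
  exact hφ

lemma Cx.ExactAt.restrict {Q : Type u} [CommRing Q] (g : Q →+* R) {C : Cx R} {i : ℤ}
    (h : C.ExactAt i) : (C.restrict g).ExactAt i := h

lemma Cx.ExactAt.baseChange [Algebra A R] [Module.Flat A R] {C : Cx A} {i : ℤ}
    (h : C.ExactAt i) : (C.baseChange R).ExactAt i := by
  have hex : Function.Exact (C.d (i + 1) i) (C.d i (i - 1)) := fun x =>
    ⟨fun hx => h x hx, by rintro ⟨y, rfl⟩; exact C.d_d_apply _ _ _ y⟩
  exact fun x hx => (Module.Flat.lTensor_exact R hex x).1 hx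

lemma CxHom.IsQuasiIso.baseChange [Algebra A R] [Module.Flat A R] {C D : Cx A}
    {φ : CxHom C D} (hφ : φ.IsQuasiIso) : (φ.baseChange (R := R)).IsQuasiIso := by
  rw [CxHom.isQuasiIso_iff] at hφ ⊢
  suffices H : ∀ (i : ℤ) (x : TensorProduct A R (C.X i)) (y : TensorProduct A R (D.X (i + 1))),
      (C.d i (i - 1)).lTensor R x = 0 → (φ.f i).lTensor R x = (D.d (i + 1) i).lTensor R y →
      ∃ (x' : TensorProduct A R (C.X (i + 1))) (y' : TensorProduct A R (D.X (i + 1 + 1))),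
        (C.d (i + 1) i).lTensor R x' = x ∧
        y = (φ.f (i + 1)).lTensor R x' + (D.d (i + 1 + 1) (i + 1)).lTensor R y' from
    fun i x hx y hxy => H i x y hx hxy
  intro i x y hx hxy
  let α : C.X (i + 1) × D.X (i + 1 + 1) →ₗ[A] C.X i × D.X (i + 1) :=
    ((C.d (i + 1) i).comp (LinearMap.fst A _ _)).prod
      ((φ.f (i + 1)).comp (LinearMap.fst A _ _) +
        (D.d (i + 1 + 1) (i + 1)).comp (LinearMap.snd A _ _))
  let β : C.X i × D.X (i + 1) →ₗ[A] C.X (i - 1) × D.X i :=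
    ((C.d i (i - 1)).comp (LinearMap.fst A _ _)).prod
      ((φ.f i).comp (LinearMap.fst A _ _) - (D.d (i + 1) i).comp (LinearMap.snd A _ _))
  have hαβ : Function.Exact α β := by
    rintro ⟨a, b⟩
    constructor
    · intro h
      obtain ⟨h1, h2⟩ := Prod.ext_iff.1 h
      obtain ⟨x', y', hx', hy'⟩ := hφ i a h1 b (sub_eq_zero.1 h2)
      exact ⟨(x', y'), Prod.ext hx' hy'.symm⟩
    · rintro ⟨⟨x', y'⟩, h⟩
      obtain ⟨rfl, rfl⟩ := Prod.ext_iff.1 h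
      refine Prod.ext (C.d_d_apply _ _ _ _) ?_
      change φ.f i (C.d (i + 1) i x') -
        D.d (i + 1) i (φ.f (i + 1) x' + D.d (i + 1 + 1) (i + 1) y') = 0
      rw [map_add, D.d_d_apply, add_zero, φ.comm_apply, sub_self]
  have hT := Module.Flat.lTensor_exact R hαβ
  let z : TensorProduct A R (C.X i × D.X (i + 1)) :=
    (LinearMap.inl A _ _).lTensor R x + (LinearMap.inr A _ _).lTensor R y
  have hz : β.lTensor R z = 0 := by
    have e1 : β ∘ₗ LinearMap.inl A _ _ = LinearMap.inl A _ _ ∘ₗ C.d i (i - 1) +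
        LinearMap.inr A _ _ ∘ₗ φ.f i := by ext a <;> simp [β]
    have e2 : β ∘ₗ LinearMap.inr A _ _ = - (LinearMap.inr A _ _ ∘ₗ D.d (i + 1) i) := by
      ext a <;> simp [β]
    simp only [z, map_add]
    rw [← LinearMap.lTensor_comp_apply, ← LinearMap.lTensor_comp_apply, e1, e2,
      LinearMap.lTensor_add, LinearMap.lTensor_neg, LinearMap.add_apply, LinearMap.neg_apply,
      LinearMap.lTensor_comp_apply, LinearMap.lTensor_comp_apply, LinearMap.lTensor_comp_apply,
      hx, hxy, map_zero, zero_add, add_neg_cancel]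
  obtain ⟨w, hw⟩ := (hT z).1 hz
  refine ⟨(LinearMap.fst A _ _).lTensor R w, (LinearMap.snd A _ _).lTensor R w, ?_, ?_⟩
  · have h := congrArg ((LinearMap.fst A _ _).lTensor R) hw
    simp only [z, map_add] at h
    rw [← LinearMap.lTensor_comp_apply, ← LinearMap.lTensor_comp_apply,
      ← LinearMap.lTensor_comp_apply, LinearMap.fst_comp_inl, LinearMap.fst_comp_inr,
      LinearMap.lTensor_id, LinearMap.lTensor_zero, LinearMap.fst_prod,
      LinearMap.lTensor_comp_apply] at h
    simpa using h
  · have h := congrArg ((LinearMap.snd A _ _).lTensor R) hw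
    simp only [z, map_add] at h
    rw [← LinearMap.lTensor_comp_apply, ← LinearMap.lTensor_comp_apply,
      ← LinearMap.lTensor_comp_apply, LinearMap.snd_comp_inl, LinearMap.snd_comp_inr,
      LinearMap.lTensor_id, LinearMap.lTensor_zero, LinearMap.snd_prod, LinearMap.lTensor_add,
      LinearMap.add_apply, LinearMap.lTensor_comp_apply, LinearMap.lTensor_comp_apply] at h
    simpa using h.symm

end BaseChange

section Restriction

variable {Q R : Type u} [CommRing Q] [CommRing R] (g : Q →+* R)

lemma IsResolvingClass.compHom {𝒞 : ∀ (N : Type u) [AddCommGroup N] [Module Q N], Prop}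
    (h𝒞 : IsResolvingClass 𝒞) (hR : @𝒞 R _ (Module.compHom R g))
    (N : Type u) [AddCommGroup N] [Module R N] [Module.Free R N] [Module.Finite R N] :
    @𝒞 N _ (Module.compHom N g) := by
  let _ : Module Q R := Module.compHom R g
  let _ : Module Q N := Module.compHom N g
  rcases subsingleton_or_nontrivial R with h | h
  · have := Module.subsingleton R N
    exact h𝒞.of_subsingleton N
  · let e := (Module.finBasis R N).equivFun.symm
    let e' : (Fin (Module.finrank R N) → R) ≃ₗ[Q] N :=
      { e.toAddEquiv with map_smul' := fun q x => e.map_smul (g q) x }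
    exact h𝒞.of_equiv e' (h𝒞.finFun hR _)

/-- A surjective ring homomorphism identifies its target with the quotient by its kernel. -/
def compHomEquivOfSurjective (hg : Function.Surjective g) {I : Ideal Q}
    (hI : RingHom.ker g = I) :
    letI : Module Q R := Module.compHom R g
    (Q ⧸ I) ≃ₗ[Q] R :=
  letI : Module Q R := Module.compHom R g
  let l : Q →ₗ[Q] R := { g with map_smul' := fun q x => g.map_mul q x }
  (Submodule.quotEquivOfEq I (LinearMap.ker l) hI.symm).trans (l.quotKerEquivOfSurjective hg)

lemma isFPInfty_compHom (hg : Function.Surjective g) {rs : List Q}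
    (hrs : RingTheory.Sequence.IsWeaklyRegular Q rs)
    (hker : RingHom.ker g = Ideal.span {x | x ∈ rs}) :
    letI : Module Q R := Module.compHom R g
    IsFPInfty Q R ∧ ∃ k, IsPDLT Q k R := by
  let _ : Module Q R := Module.compHom R g
  obtain ⟨h1, k, h2⟩ := quotient_weaklyRegular rs hrs
  have e := compHomEquivOfSurjective g hg (I := (Ideal.ofList rs • ⊤ : Submodule Q Q))
    (by rw [hker, smul_eq_mul, Ideal.mul_top])
  exact ⟨isResolvingClass_isFPInfty.of_equiv e h1, k,
    (isResolvingClass_isPDLT k).of_equiv e h2⟩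

end Restriction

/-- If the cokernel of `d : F_{n+1} → F_n` in degrees above the homology of `F` has finite
projective dimension over `Q` after base change to `R`, then so does the complex `F`. -/
lemma Cx.hasFinitePD_restrict_baseChange {R Q : Type u} [CommRing R] [CommRing Q] [Algebra A R]
    [Module.Flat A R] (g : Q →+* R) (hg : Function.Surjective g) {rs : List Q}
    (hrs : RingTheory.Sequence.IsWeaklyRegular Q rs)
    (hker : RingHom.ker g = Ideal.span {x | x ∈ rs})
    (F : Cx A) (n₀ n : ℤ) (hF₀ : ∀ i < n₀, Subsingleton (F.X i))
    (hF : ∀ i, Module.Free A (F.X i) ∧ Module.Finite A (F.X i))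
    (hex : ∀ i, n < i → F.ExactAt i)
    (hM : letI : Module Q (TensorProduct A R (F.X n ⧸ LinearMap.range (F.d (n + 1) n))) :=
        Module.compHom _ g
      HasFiniteProjDim Q (TensorProduct A R (F.X n ⧸ LinearMap.range (F.d (n + 1) n)))) :
    ((F.baseChange R).restrict g).HasFinitePD := by
  let _ : Module Q (TensorProduct A R (F.X n ⧸ LinearMap.range (F.d (n + 1) n))) :=
    Module.compHom _ g
  let _ : Module Q R := Module.compHom R g
  obtain ⟨h1, c, hc⟩ := isFPInfty_compHom g hg hrs hker
  obtain ⟨k, hk⟩ := exists_isPDLT_of_hasFiniteProjDim hM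
  let q := (LinearMap.range (F.d (n + 1) n)).mkQ
  have hq := lTensor_exact R (LinearMap.exact_map_mkQ_range (F.d (n + 1) n))
    (Submodule.mkQ_surjective _)
  let π : ((F.baseChange R).restrict g).X n →ₗ[Q]
      TensorProduct A R (F.X n ⧸ LinearMap.range (F.d (n + 1) n)) :=
    { toFun := q.baseChange R
      map_add' := (q.baseChange R).map_add
      map_smul' := fun a x => (q.baseChange R).map_smul (g a) x }
  refine Cx.hasFinitePD_of_cokernel _ (min n₀ n) n (min_le_right _ _) (fun j hj => ?_)
    (fun j => ?_) (max 1 (max c k)) (le_max_left _ _) (fun j => ?_)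
    (fun i hi => ((hex i hi).baseChange).restrict g) π ?_ ?_
    (hk.mono ((le_max_right _ _).trans (le_max_right _ _)))
  · have := hF₀ j (hj.trans_le (min_le_left _ _))
    exact inferInstanceAs (Subsingleton (TensorProduct A R (F.X j)))
  · have := (hF j).1
    have := (hF j).2
    exact isResolvingClass_isFPInfty.compHom g h1 (TensorProduct A R (F.X j))
  · have := (hF j).1
    have := (hF j).2
    exact (isResolvingClass_isPDLT _).compHom g
      (IsPDLT.mono hc ((le_max_left _ _).trans (le_max_right _ _))) (TensorProduct A R (F.X j))
  · exact LinearMap.lTensor_surjective R (Submodule.mkQ_surjective _)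
  · exact hq

/-- **Proposition 4.3.** Let `C` be a homologically finite complex of `A`-modules, and
let `F` be a minimal complex of finitely generated free `A`-modules quasi-isomorphic to
`C`. If for some `n ≥ sup C` the `A`-module `Coker(F_{n+1} → F_n)` has finite
CI-dimension, then so does the complex `C`. -/
theorem complex_hasFiniteCIDim_of_cokernel (A : Type u) [CommRing A] [IsNoetherianRing A]
    [IsLocalRing A]
    (C : Cx A) (hhf : C.HomFinite)
    (F : Cx A) (hF : IsMinFreeResCx F C)
    (n : ℤ) (hsup : ∀ i : ℤ, n < i → Subsingleton (C.homology i))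
    (hci : HasFiniteCIDimMod A (F.X n ⧸ LinearMap.range (F.d (n + 1) n))) :
    Cx.HasFiniteCIDim A C := by
  obtain ⟨⟨⟨n₀, hn₀⟩, hfree, -⟩, φ, hφ⟩ := hF
  obtain ⟨R, Q, _, _, _, _, f, g, hf, hg, hgs, ⟨rs, hrs, hker⟩, hflat, hpd⟩ := hci
  refine ⟨R, Q, _, _, ‹_›, ‹_›, f, g, hf, hg, hgs, ⟨rs, hrs, hker⟩, hflat, ?_⟩
  let _ : Algebra A R := f.toAlgebra
  have : Module.Flat A R := hflat
  have hex (i : ℤ) (hi : n < i) : F.ExactAt i :=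
    have := hsup i hi
    (F.exactAt_iff i).2 (hφ i).injective.subsingleton
  obtain ⟨P, hP, ψ, hψ⟩ := F.hasFinitePD_restrict_baseChange g hgs hrs.toIsWeaklyRegular hker
    n₀ n hn₀ hfree hex hpd
  exact ⟨P, hP, _, (hφ.baseChange.restrict g).comp hψ⟩
end
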